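/- arXiv:2005.12243 — 2 statements merged into one kernel-verified Lean document; each statement's English description precedes it below -/
import Mathlib

section
/- There exists an absolute constant C ≥ 1 such that for every integer d ≥ 2 and every integer n with n ≥ e^d · d · ln d, one has disp*(n, d) ≤ (C · ln d / n) · ln(n / ln d). -/
open MeasureTheory Set

noncomputable section

/-- The unit cube `Q_d = [0,1]^d`. -/
def cube (d : ℕ) : Set (Fin d → ℝ) := Set.univ.pi fun _ => Set.Icc (0 : ℝ) 1

/-- `B` is an axis-parallel box `∏ [aᵢ, bᵢ)` contained in the unit cube. -/
def IsBox {d : ℕ} (B : Set (Fin d → ℝ)) : Prop :=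
  ∃ a b : Fin d → ℝ, (∀ i, 0 ≤ a i ∧ a i ≤ b i ∧ b i ≤ 1) ∧
    B = Set.univ.pi fun i => Set.Ico (a i) (b i)

/-- Dispersion of a point set `P ⊆ Q_d`: the supremum of volumes of boxes avoiding `P`. -/
def disp {d : ℕ} (P : Set (Fin d → ℝ)) : ℝ :=
  sSup {v : ℝ | ∃ B : Set (Fin d → ℝ), IsBox B ∧ B ∩ P = ∅ ∧ v = (volume B).toReal}

/-- Minimal dispersion `disp*(n,d)` over all `n`-point subsets of the cube. -/
def minDisp (n d : ℕ) : ℝ :=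
  sInf {v : ℝ | ∃ P : Finset (Fin d → ℝ),
    ↑P ⊆ cube d ∧ P.card = n ∧ v = disp (↑P : Set (Fin d → ℝ))}

lemma box_vol {d : ℕ} (a b : Fin d → ℝ) (h : ∀ i, a i ≤ b i) :
    (volume (Set.univ.pi fun i => Set.Ico (a i) (b i))).toReal = ∏ i, (b i - a i) := by
  exact Real.volume_pi_Ico_toReal h

lemma exists_ext {α : Type} {s : Set α} (hs : s.Infinite) {n : ℕ} (P : Finset α)
    (hP : ↑P ⊆ s) (hc : P.card ≤ n) :
    ∃ Q : Finset α, P ⊆ Q ∧ ↑Q ⊆ s ∧ Q.card = n := by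
  classical
  induction n, hc using Nat.le_induction with
  | base => exact ⟨P, Finset.Subset.refl _, hP, rfl⟩
  | succ m _ ih =>
    obtain ⟨Q, h1, h2, h3⟩ := ih
    obtain ⟨x, hx, hxQ⟩ := hs.exists_notMem_finset Q
    refine ⟨insert x Q, h1.trans (Finset.subset_insert _ _), ?_, ?_⟩
    · rw [Finset.coe_insert]
      exact Set.insert_subset hx h2
    · rw [Finset.card_insert_of_notMem hxQ, h3]

lemma minDisp_le_of {n d : ℕ} {ε : ℝ} (hε : 0 ≤ ε) (hd : 1 ≤ d) (P : Finset (Fin d → ℝ))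
    (hP : ↑P ⊆ cube d) (hc : P.card ≤ n)
    (h : ∀ a b : Fin d → ℝ, (∀ i, 0 ≤ a i ∧ a i ≤ b i ∧ b i ≤ 1) → ε < ∏ i, (b i - a i) →
      ∃ p ∈ P, p ∈ Set.univ.pi fun i => Set.Ico (a i) (b i)) : minDisp n d ≤ ε := by
  have hinf : (cube d).Infinite := by
    have hinj : Function.Injective (fun (t : ℝ) (_ : Fin d) => t) := by
      intro s t hst
      exact congrFun hst ⟨0, hd⟩
    have h1 : ((fun (t : ℝ) (_ : Fin d) => t) '' Set.Icc (0:ℝ) 1).Infinite :=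
      (Set.Icc_infinite (by norm_num)).image hinj.injOn
    refine h1.mono ?_
    rintro _ ⟨t, ht, rfl⟩
    intro i _
    exact ht
  obtain ⟨Q, hPQ, hQ, hQn⟩ := exists_ext hinf P hP hc
  have h1 : minDisp n d ≤ disp (↑Q : Set (Fin d → ℝ)) := by
    apply csInf_le
    · refine ⟨0, ?_⟩
      rintro _ ⟨P, -, -, rfl⟩
      apply Real.sSup_nonneg
      rintro _ ⟨B, -, -, rfl⟩
      exact ENNReal.toReal_nonneg
    · exact ⟨Q, hQ, hQn, rfl⟩
  refine h1.trans ?_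
  apply Real.sSup_le _ hε
  rintro _ ⟨_, ⟨a, b, hab, rfl⟩, hB, rfl⟩
  rw [box_vol a b fun i => (hab i).2.1]
  by_contra hlt
  obtain ⟨p, hp, hpB⟩ := h a b hab (not_le.mp hlt)
  have : p ∈ (∅ : Set (Fin d → ℝ)) := by
    rw [← hB]
    exact ⟨hpB, hPQ hp⟩
  exact this

lemma exists_good {d : ℕ} {ι : Type} (S : ι → Set (Fin d → ℝ)) {δ : ℝ} (hδ : 0 < δ)
    (F : Finset ι) (hF : F.Nonempty) (hm : ∀ i ∈ F, MeasurableSet (S i))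
    (hs : ∀ i ∈ F, S i ⊆ cube d) (hv : ∀ i ∈ F, δ ≤ (volume (S i)).toReal) :
    ∃ x ∈ cube d, δ * F.card ≤ ∑ i ∈ F, (S i).indicator (fun _ => (1:ℝ)) x := by
  have hcv : volume (cube d) = 1 := by
    unfold cube
    rw [volume_pi_pi]
    simp
  have : IsProbabilityMeasure (volume.restrict (cube d)) := ⟨by simp [hcv]⟩
  have hint : ∀ i ∈ F, Integrable ((S i).indicator (fun _ => (1:ℝ))) (volume.restrict (cube d)) :=
    fun i hi => (integrable_const (1:ℝ)).indicator (hm i hi)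
  obtain ⟨x, hx⟩ := exists_integral_le (integrable_finsetSum F hint)
  rw [integral_finsetSum F hint] at hx
  have h2 : δ * F.card ≤ ∑ i ∈ F, (S i).indicator (fun _ => (1:ℝ)) x := by
    refine le_trans ?_ hx
    rw [mul_comm, ← nsmul_eq_mul]
    apply Finset.card_nsmul_le_sum
    intro i hi
    rw [integral_indicator_const _ (hm i hi)]
    rw [measureReal_def, Measure.restrict_apply (hm i hi), inter_eq_left.mpr (hs i hi)]
    simpa using hv i hi
  refine ⟨x, ?_, h2⟩
  have hpos : 0 < δ * F.card := mul_pos hδ (by exact_mod_cast hF.card_pos)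
  obtain ⟨i, hi, hne⟩ := Finset.exists_ne_zero_of_sum_ne_zero (hpos.trans_le h2).ne'
  exact hs i hi (Set.mem_of_indicator_ne_zero hne)

open Classical in
lemma hitting {d : ℕ} {ι : Type} (S : ι → Set (Fin d → ℝ)) {δ : ℝ} (hδ : 0 < δ) (hδ1 : δ ≤ 1)
    (F : Finset ι) (hm : ∀ i ∈ F, MeasurableSet (S i))
    (hs : ∀ i ∈ F, S i ⊆ cube d) (hv : ∀ i ∈ F, δ ≤ (volume (S i)).toReal) (m : ℕ) :
    ∃ P : Finset (Fin d → ℝ), ↑P ⊆ cube d ∧ P.card ≤ m ∧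
      ((F.filter (fun i => ∀ p ∈ P, p ∉ S i)).card : ℝ) ≤ F.card * (1 - δ) ^ m := by
  induction m with
  | zero => exact ⟨∅, by simp, by simp, by simp⟩
  | succ m ih =>
    obtain ⟨P, hP, hc, hN⟩ := ih
    set G := F.filter (fun i => ∀ p ∈ P, p ∉ S i) with hG
    have hGF : ∀ i ∈ G, i ∈ F := fun i hi => (Finset.mem_filter.mp hi).1
    rcases G.eq_empty_or_nonempty with h0 | hne
    · refine ⟨P, hP, hc.trans (Nat.le_succ m), ?_⟩
      rw [← hG, h0]
      have : 0 ≤ 1 - δ := by linarith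
      simp only [Finset.card_empty, Nat.cast_zero]
      positivity
    · obtain ⟨x, hx, hxs⟩ := exists_good S hδ G hne (fun i hi => hm i (hGF i hi))
        (fun i hi => hs i (hGF i hi)) (fun i hi => hv i (hGF i hi))
      refine ⟨insert x P, ?_, (Finset.card_insert_le _ _).trans (by omega), ?_⟩
      · rw [Finset.coe_insert]
        exact Set.insert_subset hx hP
      · have e1 : F.filter (fun i => ∀ p ∈ insert x P, p ∉ S i) = G.filter (fun i => ¬ x ∈ S i) := by
          ext i
          simp only [hG, Finset.mem_filter, Finset.forall_mem_insert]
          tauto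
        have e2 : ∑ i ∈ G, (S i).indicator (fun _ => (1:ℝ)) x
            = ((G.filter (fun i => x ∈ S i)).card : ℝ) := by
          rw [Finset.card_filter]
          push_cast
          apply Finset.sum_congr rfl
          intro i _
          simp [Set.indicator_apply]
        have e3 := Finset.card_filter_add_card_filter_not (s := G) (fun i => x ∈ S i)
        have e4 : ((G.filter (fun i => x ∈ S i)).card : ℝ)
          + ((G.filter (fun i => ¬ x ∈ S i)).card : ℝ) = G.card := by exact_mod_cast e3
        rw [e1, pow_succ]
        have : (0:ℝ) ≤ 1 - δ := by linarith
        have := mul_le_mul_of_nonneg_right hN this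
        rw [e2] at hxs
        nlinarith

/-- the index family -/
def fam (d L : ℕ) : Finset ((_ : Fin d → ℕ) × (Fin d → ℕ × ℕ)) :=
  ((Fintype.piFinset fun _ : Fin d => Finset.range (L+1)).filter (fun k => ∑ i, k i ≤ L)).sigma
    fun k => Fintype.piFinset fun i =>
      Finset.range (8 * d * 2 ^ k i + 1) ×ˢ Finset.range (8 * d * 2 ^ k i + 1)

lemma profiles_card (d L : ℕ) :
    ((((Fintype.piFinset fun _ : Fin d => Finset.range (L+1)).filter
      (fun k => ∑ i, k i ≤ L)).card : ℕ) : ℝ) ≤ 2 ^ L * 2 ^ d := by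
  rw [Finset.card_eq_sum_ones]
  push_cast
  calc _ ≤ ∑ k ∈ ((Fintype.piFinset fun _ : Fin d => Finset.range (L+1)).filter
      (fun k => ∑ i, k i ≤ L)), (2:ℝ)^L * ∏ i, (1/2:ℝ)^(k i) := by
        apply Finset.sum_le_sum
        intro k hk
        have h := (Finset.mem_filter.mp hk).2
        rw [Finset.prod_pow_eq_pow_sum, one_div, inv_pow, ← div_eq_mul_inv, one_le_div (by positivity)]
        exact pow_le_pow_right₀ (by norm_num) h
    _ ≤ ∑ k ∈ (Fintype.piFinset fun _ : Fin d => Finset.range (L+1)),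
          (2:ℝ)^L * ∏ i, (1/2:ℝ)^(k i) := by
        apply Finset.sum_le_sum_of_subset_of_nonneg (Finset.filter_subset _ _)
        intros; positivity
    _ = (2:ℝ)^L * ∏ _i : Fin d, ∑ j ∈ Finset.range (L+1), (1/2:ℝ)^j := by
        rw [← Finset.mul_sum, Finset.prod_univ_sum]
    _ ≤ 2^L * 2^d := by
        rw [Finset.prod_const, Finset.card_univ, Fintype.card_fin]
        gcongr
        have := geom_sum_eq (show (1/2:ℝ) ≠ 1 by norm_num) (L+1)
        rw [this]
        have : (0:ℝ) < (1/2)^(L+1) := by positivity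
        rw [div_le_iff_of_neg (by norm_num)]
        linarith

lemma fam_card (d L : ℕ) (hd : 1 ≤ d) : ((fam d L).card : ℝ) ≤ 8 ^ L * (162 * d ^ 2) ^ d := by
  have hd' : (1:ℝ) ≤ d := by exact_mod_cast hd
  unfold fam
  rw [Finset.card_sigma]
  push_cast
  calc _ ≤ ∑ k ∈ ((Fintype.piFinset fun _ : Fin d => Finset.range (L+1)).filter
      (fun k => ∑ i, k i ≤ L)), (4:ℝ)^L * (81 * d^2)^d := by
        apply Finset.sum_le_sum
        intro k hk
        have h := (Finset.mem_filter.mp hk).2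
        rw [Fintype.card_piFinset]
        push_cast
        calc (∏ i : Fin d, (((Finset.range (8 * d * 2 ^ k i + 1) ×ˢ
              Finset.range (8 * d * 2 ^ k i + 1)).card : ℕ) : ℝ))
            ≤ ∏ i : Fin d, ((4:ℝ)^(k i) * (81 * (d:ℝ)^2)) := by
              apply Finset.prod_le_prod
              · intros; positivity
              · intro i _
                rw [Finset.card_product, Finset.card_range]
                push_cast
                have h2 : (1:ℝ) ≤ 2 ^ k i := one_le_pow₀ (by norm_num)
                have h4 : (4:ℝ)^ k i = (2^k i)^2 := by
                  rw [← pow_mul, mul_comm, pow_mul]; norm_num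
                rw [h4]
                have h1 : (1:ℝ) ≤ d * 2 ^ k i := one_le_mul_of_one_le_of_one_le hd' h2
                nlinarith
          _ = (4:ℝ) ^ (∑ i, k i) * (81 * (d:ℝ)^2)^d := by
              rw [Finset.prod_mul_distrib, Finset.prod_pow_eq_pow_sum]
              simp
          _ ≤ _ := by
              gcongr
              norm_num
    _ ≤ (2^L * 2^d) * ((4:ℝ)^L * (81 * d^2)^d) := by
        rw [Finset.sum_const, nsmul_eq_mul]
        gcongr
        exact profiles_card d L
    _ = _ := by
        have e1 : (8:ℝ)^L = 2^L * 4^L := by rw [← mul_pow]; norm_num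
        have e2 : ((162:ℝ) * d^2)^d = 2^d * (81 * d^2)^d := by
          rw [← mul_pow]; congr 1; ring
        rw [e1, e2]
        ring

/-- grid boxes -/
def gbox (d : ℕ) (t : (_ : Fin d → ℕ) × (Fin d → ℕ × ℕ)) : Set (Fin d → ℝ) :=
  Set.univ.pi fun i => Set.Ico (((t.2 i).1 : ℝ) / (8 * d * 2 ^ t.1 i)) (((t.2 i).2 : ℝ) / (8 * d * 2 ^ t.1 i))

lemma gbox_sub (d L : ℕ) (hd : 1 ≤ d) (t) (ht : t ∈ fam d L) : gbox d t ⊆ cube d := by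
  have hd' : (1:ℝ) ≤ d := by exact_mod_cast hd
  intro x hx i hi
  have h := hx i hi
  unfold fam at ht
  have h2 := Fintype.mem_piFinset.mp (Finset.mem_sigma.mp ht).2 i
  have h3 := Finset.mem_range.mp (Finset.mem_product.mp h2).2
  have h4 : ((t.2 i).2 : ℝ) ≤ 8 * d * 2 ^ t.1 i := by exact_mod_cast Nat.lt_succ_iff.mp h3
  refine ⟨le_trans (by positivity) h.1, h.2.le.trans ?_⟩
  exact div_le_one_of_le₀ h4 (by positivity)

lemma one_dim (d : ℕ) (hd : 1 ≤ d) (a b : ℝ) (ha : 0 ≤ a) (hab : a < b) (hb : b ≤ 1) :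
    ∃ k u v : ℕ, b - a ≤ (1/2)^k ∧ u ≤ 8 * d * 2 ^ k ∧ v ≤ 8 * d * 2 ^ k ∧
      a ≤ (u:ℝ) / (8 * d * 2 ^ k) ∧ (v:ℝ) / (8 * d * 2 ^ k) ≤ b ∧
      (b - a) * (1 - 1 / (2 * d)) ≤ (v:ℝ) / (8 * d * 2 ^ k) - (u:ℝ) / (8 * d * 2 ^ k) := by
  have hd' : (1:ℝ) ≤ d := by exact_mod_cast hd
  obtain ⟨k, hk1, hk2⟩ := exists_nat_pow_near_of_lt_one (x := b - a) (y := (1/2:ℝ))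
    (by linarith) (by linarith) (by norm_num) (by norm_num)
  have hM : (0:ℝ) < 8 * d * 2 ^ k := by positivity
  set M : ℝ := 8 * d * 2 ^ k with hMdef
  refine ⟨k, ⌈a * M⌉₊, ⌊b * M⌋₊, hk2, ?_, ?_, ?_, ?_, ?_⟩
  · apply Nat.ceil_le.mpr
    push_cast
    rw [← hMdef]
    nlinarith
  · apply Nat.floor_le_of_le
    push_cast
    rw [← hMdef]
    nlinarith
  · rw [le_div_iff₀ hM]
    exact Nat.le_ceil _
  · rw [div_le_iff₀ hM]
    exact Nat.floor_le (by nlinarith)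
  · rw [← sub_div, le_div_iff₀ hM]
    have h1 := Nat.ceil_lt_add_one (a := a * M) (by positivity)
    have h2 := Nat.sub_one_lt_floor (b * M)
    have h3 : (b - a) * (1 - 1 / (2 * d)) * M = (b - a) * M - (b - a) * (4 * 2^k) := by
      rw [hMdef]; field_simp; ring
    have h4 : 2 ≤ (b - a) * (4 * 2 ^ k) := by
      have : (1/2:ℝ)^(k+1) * (4 * 2^k) = 2 := by
        rw [pow_succ, one_div, inv_pow]; field_simp; norm_num
      calc (2:ℝ) = (1/2:ℝ)^(k+1) * (4 * 2^k) := this.symm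
        _ ≤ _ := by gcongr
    rw [h3]
    nlinarith

lemma approx (d L : ℕ) (hd : 1 ≤ d) (a b : Fin d → ℝ)
    (hab : ∀ i, 0 ≤ a i ∧ a i ≤ b i ∧ b i ≤ 1) (hvol : (1/2:ℝ)^L < ∏ i, (b i - a i)) :
    ∃ t ∈ fam d L, gbox d t ⊆ (Set.univ.pi fun i => Set.Ico (a i) (b i)) ∧
      (1/2:ℝ)^L / 2 ≤ (volume (gbox d t)).toReal := by
  have hd' : (1:ℝ) ≤ d := by exact_mod_cast hd
  have hpos : 0 < ∏ i, (b i - a i) := lt_trans (by positivity) hvol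
  have hlt : ∀ i, a i < b i := by
    intro i
    refine lt_of_le_of_ne (hab i).2.1 fun h => ?_
    rw [Finset.prod_eq_zero (Finset.mem_univ i) (by rw [h, sub_self])] at hpos
    exact lt_irrefl _ hpos
  choose k u v h1 h2 h3 h4 h5 h6 using fun i =>
    one_dim d hd (a i) (b i) (hab i).1 (hlt i) (hab i).2.2
  have hc : 0 ≤ 1 - 1 / (2 * (d:ℝ)) := by
    rw [sub_nonneg, div_le_one (by positivity)]; linarith
  have hsum : ∑ i, k i ≤ L := by
    have : (1/2:ℝ)^L < (1/2)^(∑ i, k i) := by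
      refine hvol.trans_le ?_
      rw [← Finset.prod_pow_eq_pow_sum]
      exact Finset.prod_le_prod (fun i _ => by linarith [hlt i]) (fun i _ => h1 i)
    exact ((pow_lt_pow_iff_right_of_lt_one₀ (by norm_num) (by norm_num)).mp this).le
  refine ⟨⟨k, fun i => (u i, v i)⟩, ?_, ?_, ?_⟩
  · unfold fam
    rw [Finset.mem_sigma, Finset.mem_filter, Fintype.mem_piFinset, Fintype.mem_piFinset]
    refine ⟨⟨fun i => ?_, hsum⟩, fun i => ?_⟩
    · rw [Finset.mem_range]
      have := Finset.single_le_sum (f := k) (fun i _ => Nat.zero_le _) (Finset.mem_univ i)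
      dsimp only
      omega
    · rw [Finset.mem_product, Finset.mem_range, Finset.mem_range]
      exact ⟨Nat.lt_succ_of_le (h2 i), Nat.lt_succ_of_le (h3 i)⟩
  · intro x hx i hi
    exact ⟨(h4 i).trans (hx i hi).1, (hx i hi).2.trans_le (h5 i)⟩
  · unfold gbox
    rw [box_vol]
    · calc (1/2:ℝ)^L / 2 ≤ (∏ i, (b i - a i)) * (1 - 1 / (2 * (d:ℝ)))^d := by
            have hb := one_add_mul_le_pow (a := -(1 / (2 * (d:ℝ)))) (by linarith) d
            have e : 1 + (d:ℝ) * -(1 / (2 * (d:ℝ))) = 1/2 := by field_simp; norm_num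
            rw [e, ← sub_eq_add_neg] at hb
            rw [div_eq_mul_one_div]
            gcongr
        _ = ∏ i, ((b i - a i) * (1 - 1 / (2 * (d:ℝ)))) := by
            rw [Finset.prod_mul_distrib]; simp
        _ ≤ _ := Finset.prod_le_prod
            (fun i _ => mul_nonneg (by linarith [hlt i]) hc) (fun i _ => h6 i)
    · intro i
      have := mul_nonneg (sub_nonneg.mpr (hlt i).le) hc
      have := h6 i
      dsimp only
      linarith

lemma main_comb (d L n : ℕ) (hd : 1 ≤ d)
    (h : (8:ℝ) ^ L * (162 * d ^ 2) ^ d * (1 - (1/2:ℝ)^L / 2) ^ n < 1) :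
    minDisp n d ≤ (1/2:ℝ)^L := by
  classical
  have hle : (1/2:ℝ)^L ≤ 1 := pow_le_one₀ (by norm_num) (by norm_num)
  have hp : (0:ℝ) < (1/2:ℝ)^L := by positivity
  set F := (fam d L).filter (fun t => (1/2:ℝ)^L / 2 ≤ (volume (gbox d t)).toReal) with hF
  obtain ⟨P, hP, hc, hN⟩ := hitting (gbox d) (δ := (1/2:ℝ)^L / 2) (by positivity) (by linarith)
    F (fun i _ => MeasurableSet.univ_pi fun _ => measurableSet_Ico)
    (fun i hi => gbox_sub d L hd i (Finset.mem_filter.mp hi).1)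
    (fun i hi => (Finset.mem_filter.mp hi).2) n
  have hq : (0:ℝ) ≤ 1 - (1/2:ℝ)^L / 2 := by linarith
  have hFc : (F.card : ℝ) ≤ 8 ^ L * (162 * d ^ 2) ^ d :=
    le_trans (by exact_mod_cast Finset.card_filter_le _ _) (fam_card d L hd)
  have hlt := (hN.trans (mul_le_mul_of_nonneg_right hFc (pow_nonneg hq n))).trans_lt h
  have h0 : (F.filter (fun i => ∀ p ∈ P, p ∉ gbox d i)).card = 0 :=
    Nat.lt_one_iff.mp (by exact_mod_cast hlt)
  refine minDisp_le_of hp.le hd P hP hc ?_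
  intro a b hab hv
  obtain ⟨t, ht, hsub, htv⟩ := approx d L hd a b hab hv
  by_contra hcon
  push Not at hcon
  have : t ∈ F.filter (fun i => ∀ p ∈ P, p ∉ gbox d i) :=
    Finset.mem_filter.mpr ⟨Finset.mem_filter.mpr ⟨ht, htv⟩, fun p hp hpt => hcon p hp (hsub hpt)⟩
  rw [Finset.card_eq_zero.mp h0] at this
  simp at this

lemma minDisp_le_one (n d : ℕ) (hd : 1 ≤ d) : minDisp n d ≤ 1 := by
  refine minDisp_le_of zero_le_one hd ∅ (by simp) (by simp) ?_
  intro a b hab hv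
  exfalso
  refine absurd hv (not_lt.mpr ?_)
  apply Finset.prod_le_one
  · intro i _; linarith [hab i]
  · intro i _; linarith [hab i]

/-- There exists an absolute constant `C ≥ 1` such that for every integer `d ≥ 2` and every
integer `n ≥ e^d · d · ln d`, one has `disp*(n,d) ≤ (C ln d / n) · ln(n / ln d)`. -/
theorem minimal_dispersion_bound_large_n :
    ∃ C : ℝ, 1 ≤ C ∧ ∀ d : ℕ, 2 ≤ d → ∀ n : ℕ,
      Real.exp d * d * Real.log d ≤ (n : ℝ) →
      minDisp n d ≤ C * Real.log d / n * Real.log (n / Real.log d) := by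
  refine ⟨128, by norm_num, fun d hd n hn => ?_⟩
  have hd2 : (2:ℝ) ≤ d := by exact_mod_cast hd
  have hl : 0.69 ≤ Real.log d :=
    le_trans (by linarith [Real.log_two_gt_d9]) (Real.log_le_log (by norm_num) hd2)
  have hl0 : 0 < Real.log d := by linarith
  set l := Real.log d with hldef
  have hnpos : (0:ℝ) < n := lt_of_lt_of_le (by positivity) hn
  set X : ℝ := n / l with hX
  have hXd : Real.exp d ≤ X := by
    rw [hX, le_div_iff₀ hl0]
    refine le_trans ?_ hn
    have := Real.exp_pos d
    have : Real.exp d * 1 ≤ Real.exp d * d := by gcongr; linarith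
    nlinarith
  have hX0 : 0 < X := by positivity
  have hlX : (d:ℝ) ≤ Real.log X := (Real.le_log_iff_exp_le hX0).mpr hXd
  set Y := Real.log X with hY
  have hY2 : 2 ≤ Y := hd2.trans hlX
  have hrw : 128 * l / n * Y = 128 * Y / X := by
    rw [hX]; field_simp
  rw [hrw]
  rcases lt_or_ge X (64 * Y) with hlt | hge
  · refine (minDisp_le_one n d (by omega)).trans ?_
    rw [le_div_iff₀ hX0]; linarith
  · obtain ⟨L, hL1, hL2⟩ := exists_nat_pow_near (x := X / (64 * Y)) (y := (2:ℝ))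
      (by rw [le_div_iff₀ (by positivity)]; linarith) (by norm_num)
    refine (main_comb d L n (by omega) ?_).trans ?_
    · have hLX : (2:ℝ)^L ≤ X := hL1.trans (div_le_self hX0.le (by linarith))
      have hXe : X = Real.exp Y := (Real.exp_log hX0).symm
      have h8 : (8:ℝ)^L ≤ Real.exp (3 * Y) := by
        rw [show (8:ℝ) = 2^3 by norm_num, ← pow_mul, mul_comm, pow_mul]
        calc ((2:ℝ)^L)^3 ≤ X^3 := by gcongr
          _ = _ := by rw [hXe, ← Real.exp_nat_mul]; norm_num
      have hde : (d:ℝ) = Real.exp l := (Real.exp_log (by linarith)).symm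
      have h162 : (162:ℝ) ≤ Real.exp 6 := by
        have : (2.7:ℝ)^6 ≤ (Real.exp 1)^6 := by
          gcongr
          linarith [Real.exp_one_gt_d9]
        rw [← Real.exp_nat_mul] at this
        norm_num at this
        linarith
      have hdd : ((162:ℝ) * d^2)^d ≤ Real.exp (Y * (6 + 2 * l)) := by
        calc ((162:ℝ) * d^2)^d ≤ (Real.exp (6 + 2 * l))^d := by
              rw [Real.exp_add]
              gcongr
              have : (d:ℝ)^2 = Real.exp (2 * l) := by
                rw [two_mul, Real.exp_add, ← hde, sq]
              exact this.le
          _ = Real.exp (d * (6 + 2 * l)) := by rw [← Real.exp_nat_mul]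
          _ ≤ _ := by
              apply Real.exp_le_exp.mpr
              gcongr
      have hp1 : (1/2:ℝ)^L ≤ 1 := pow_le_one₀ (by norm_num) (by norm_num)
      have hpow : (1 - (1/2:ℝ)^L / 2)^n ≤ Real.exp (-(32 * Y * l)) := by
        calc (1 - (1/2:ℝ)^L / 2)^n ≤ (Real.exp (-((1/2:ℝ)^L / 2)))^n := by
              gcongr
              · linarith
              · exact Real.one_sub_le_exp_neg _
          _ = Real.exp (n * -((1/2:ℝ)^L / 2)) := by rw [← Real.exp_nat_mul]
          _ ≤ _ := by
              apply Real.exp_le_exp.mpr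
              have h64 : 64 * Y * l ≤ n * (1/2:ℝ)^L := by
                rw [one_div, inv_pow, ← div_eq_mul_inv, le_div_iff₀ (by positivity)]
                rw [le_div_iff₀ (by positivity)] at hL1
                have : (n:ℝ) = X * l := by rw [hX]; field_simp
                rw [this]
                nlinarith
              linarith
      calc _ ≤ Real.exp (3 * Y) * Real.exp (Y * (6 + 2 * l)) * Real.exp (-(32 * Y * l)) := by
            have : 0 ≤ 1 - (1/2:ℝ)^L / 2 := by linarith
            gcongr
        _ = Real.exp (3 * Y + Y * (6 + 2 * l) + -(32 * Y * l)) := by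
            rw [Real.exp_add, Real.exp_add]
        _ < 1 := by
            rw [Real.exp_lt_one_iff]
            nlinarith
    · rw [one_div, inv_pow, inv_le_comm₀ (by positivity) (by positivity), inv_div]
      rw [pow_succ] at hL2
      rw [div_lt_iff₀ (by positivity)] at hL2
      rw [div_le_iff₀ (by positivity)]
      linarith
end
end

section
/- There exists an absolute constant C ≥ 1 such that for every integer d ≥ 2 and every ε ∈ (0, 1/2] with ε ≤ exp(-d), one has Ñ(ε, d) ≤ (C · ln d / ε) · ln(1/ε). -/
open MeasureTheory Set

noncomputable section

/-- The periodic interval `I(s,t)`: `(s,t)` if `s < t`, and `[0,1] \ [t,s]` if `t < s`. -/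
def perInterval (s t : ℝ) : Set ℝ :=
  if s < t then Set.Ioo s t else Set.Icc 0 1 \ Set.Icc t s

/-- `B` is a periodic axis-parallel box in the unit cube. -/
def IsPerBox {d : ℕ} (B : Set (Fin d → ℝ)) : Prop :=
  ∃ a b : Fin d → ℝ, a ∈ cube d ∧ b ∈ cube d ∧ (∀ i, a i ≠ b i) ∧
    B = Set.univ.pi fun i => perInterval (a i) (b i)

/-- Periodic dispersion of a point set `P ⊆ Q_d`. -/
def pdisp {d : ℕ} (P : Set (Fin d → ℝ)) : ℝ :=
  sSup {v : ℝ | ∃ B : Set (Fin d → ℝ), IsPerBox B ∧ B ∩ P = ∅ ∧ v = (volume B).toReal}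

/-- Minimal periodic dispersion `disp̃*(n,d)`. -/
def pminDisp (n d : ℕ) : ℝ :=
  sInf {v : ℝ | ∃ P : Finset (Fin d → ℝ),
    ↑P ⊆ cube d ∧ P.card = n ∧ v = pdisp (↑P : Set (Fin d → ℝ))}

/-- Inverse of the minimal periodic dispersion, `Ñ(ε,d)`. -/
def pNinv (ε : ℝ) (d : ℕ) : ℕ := sInf {n : ℕ | pminDisp n d ≤ ε}

lemma perInterval_meas (s t : ℝ) : MeasurableSet (perInterval s t) := by
  unfold perInterval
  split_ifs
  · exact measurableSet_Ioo
  · exact measurableSet_Icc.diff measurableSet_Icc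

lemma perInterval_sub {s t : ℝ} (hs : s ∈ Icc (0:ℝ) 1) (ht : t ∈ Icc (0:ℝ) 1) :
    perInterval s t ⊆ Icc 0 1 := by
  unfold perInterval
  split_ifs
  · intro x hx
    exact ⟨hs.1.trans hx.1.le, hx.2.le.trans ht.2⟩
  · exact sdiff_subset

lemma vol_lt {s t : ℝ} (h : s < t) : volume.real (perInterval s t) = t - s := by
  simp [perInterval, h, Measure.real, ENNReal.toReal_ofReal, h.le]

lemma vol_gt {s t : ℝ} (h : t ≤ s) (ht : 0 ≤ t) (hs : s ≤ 1) :
    volume.real (perInterval s t) = 1 - (s - t) := by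
  rw [perInterval, if_neg (not_lt.2 h), measureReal_sdiff (Icc_subset_Icc ht hs) measurableSet_Icc (by simp)]
  simp [Measure.real, h]

lemma one_dim_s6 {a b : ℝ} (ha : a ∈ Icc (0:ℝ) 1) (hb : b ∈ Icc (0:ℝ) 1) (hab : a ≠ b) (m : ℕ)
    (hm : 2 < volume.real (perInterval a b) * m) :
    ∃ j j' : ℕ, j ≤ m ∧ j' ≤ m ∧ perInterval (j / m) (j' / m) ⊆ perInterval a b ∧
      volume.real (perInterval a b) - 2 / m ≤ volume.real (perInterval (j / m) (j' / m)) := by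
  have hm0 : (0:ℝ) < m := by
    rcases Nat.eq_zero_or_pos m with h | h
    · subst h; norm_num at hm
    · exact_mod_cast h
  have ham : 0 ≤ a * m := mul_nonneg ha.1 hm0.le
  have hbm : 0 ≤ b * m := mul_nonneg hb.1 hm0.le
  have hj1 := Nat.le_ceil (a * m)
  have hj2 := Nat.ceil_lt_add_one ham
  have hj3 := Nat.floor_le hbm
  have hj4 := Nat.lt_floor_add_one (b * m)
  have hjm : ⌈a * m⌉₊ ≤ m := by
    apply Nat.ceil_le.2
    nlinarith [ha.2]
  have hjm' : ⌊b * m⌋₊ ≤ m := by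
    apply Nat.floor_le_of_le
    nlinarith [hb.2]
  refine ⟨⌈a * m⌉₊, ⌊b * m⌋₊, hjm, hjm', ?_⟩
  set j := ⌈a * m⌉₊
  set j' := ⌊b * m⌋₊
  have hja : a ≤ j / m := by rw [le_div_iff₀ hm0]; exact hj1
  have hjb : (j':ℝ) / m ≤ b := by rw [div_le_iff₀ hm0]; exact hj3
  have hja' : (j:ℝ) / m ≤ a + 1 / m := by
    rw [div_le_iff₀ hm0]; field_simp; linarith
  have hjb' : b - 1 / m ≤ (j':ℝ) / m := by
    rw [le_div_iff₀ hm0]; field_simp; linarith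
  have h2 : (2:ℝ) / m = 1 / m + 1 / m := by ring
  rcases lt_or_gt_of_ne hab with h | h
  · rw [vol_lt h] at hm ⊢
    have hlt : (j:ℝ) / m < j' / m := by
      rw [div_lt_div_iff_of_pos_right hm0]
      nlinarith
    rw [vol_lt hlt]
    refine ⟨?_, by linarith⟩
    rw [perInterval, perInterval, if_pos h, if_pos hlt]
    exact Ioo_subset_Ioo hja hjb
  · have hle : (j':ℝ) / m ≤ j / m := by linarith
    have h0 : (0:ℝ) ≤ j' / m := by positivity
    have h1 : (j:ℝ) / m ≤ 1 := by
      rw [div_le_one hm0]; exact_mod_cast hjm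
    rw [vol_gt hle h0 h1, vol_gt h.le hb.1 ha.2]
    refine ⟨?_, by linarith⟩
    rw [perInterval, perInterval, if_neg (not_lt.2 h.le), if_neg (not_lt.2 hle)]
    exact sdiff_subset_sdiff_right (Icc_subset_Icc hjb hja)

lemma cube_vol (d : ℕ) : volume (cube d) = 1 := by
  rw [cube, volume_pi_pi]; simp

open Classical in
lemma hit {d : ℕ} {ι : Type*} (F : Finset ι) (S : ι → Set (Fin d → ℝ)) (p : ℝ) (hp1 : p ≤ 1)
    (hS : ∀ i ∈ F, MeasurableSet (S i)) (hc : ∀ i ∈ F, S i ⊆ cube d)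
    (hp : ∀ i ∈ F, p ≤ volume.real (S i)) (N : ℕ) :
    ∃ P : Finset (Fin d → ℝ), ↑P ⊆ cube d ∧ P.card ≤ N ∧
      ((F.filter (fun i => S i ∩ (P : Set (Fin d → ℝ)) = ∅)).card : ℝ) ≤ F.card * (1 - p) ^ N := by
  induction N with
  | zero => 
    refine ⟨∅, by simp, by simp, ?_⟩
    simp
  | succ N ih =>
    obtain ⟨P, hP, hcard, hF⟩ := ih
    set G := F.filter (fun i => S i ∩ (P : Set (Fin d → ℝ)) = ∅) with hG
    have hGF : ∀ i ∈ G, i ∈ F := fun i hi => (Finset.mem_filter.1 hi).1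
    have hfin : ∀ i ∈ G, volume (S i) ≠ ⊤ := fun i hi =>
      ne_top_of_le_ne_top (by rw [cube_vol]; simp) (measure_mono (hc i (hGF i hi)))
    have hint : ∀ i ∈ G, IntegrableOn ((S i).indicator (fun _ => (1:ℝ))) (cube d) := by
      intro i hi
      apply Integrable.integrableOn
      rw [integrable_indicator_iff (hS i (hGF i hi))]
      exact integrableOn_const (hfin i hi)
    have hsum : IntegrableOn (fun x => ∑ i ∈ G, (S i).indicator (fun _ => (1:ℝ)) x) (cube d) :=
      integrable_finsetSum _ hint
    obtain ⟨x, hx, hxle⟩ := exists_setAverage_le (μ := volume) (s := cube d)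
      (by rw [cube_vol]; simp) (by rw [cube_vol]; simp) hsum
    have hav : (G.card : ℝ) * p ≤ ∑ i ∈ G, (S i).indicator (fun _ => (1:ℝ)) x := by
      refine le_trans ?_ hxle
      rw [setAverage_eq, Measure.real, cube_vol, integral_finsetSum _ hint]
      simp only [ENNReal.toReal_one, inv_one, one_smul]
      rw [← nsmul_eq_mul]
      apply Finset.card_nsmul_le_sum
      intro i hi
      rw [setIntegral_indicator (hS i (hGF i hi)), inter_eq_right.2 (hc i (hGF i hi))]
      simpa using hp i (hGF i hi)
    have hcount : ∑ i ∈ G, (S i).indicator (fun _ => (1:ℝ)) x = ((G.filter (fun i => x ∈ S i)).card : ℝ) := by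
      rw [Finset.card_filter]
      push_cast
      exact Finset.sum_congr rfl (fun i _ => by simp [indicator_apply])
    rw [hcount] at hav
    refine ⟨insert x P, ?_, (Finset.card_insert_le _ _).trans (by omega), ?_⟩
    · rw [Finset.coe_insert]; exact insert_subset hx hP
    have hsub : F.filter (fun i => S i ∩ ((insert x P : Finset _) : Set (Fin d → ℝ)) = ∅) ⊆
        G.filter (fun i => x ∉ S i) := by
      intro i hi
      rw [Finset.mem_filter] at hi
      rw [Finset.mem_filter, hG, Finset.mem_filter]
      have h2 := hi.2
      rw [Finset.coe_insert, eq_empty_iff_forall_notMem] at h2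
      refine ⟨⟨hi.1, ?_⟩, fun hxS => h2 x ⟨hxS, by simp⟩⟩
      rw [eq_empty_iff_forall_notMem]
      exact fun y hy => h2 y ⟨hy.1, mem_insert_of_mem _ hy.2⟩
    have hle := Finset.card_le_card hsub
    have hadd := Finset.card_filter_add_card_filter_not (s := G) (fun i => x ∈ S i)
    have hle' : ((F.filter (fun i => S i ∩ ((insert x P : Finset _) : Set (Fin d → ℝ)) = ∅)).card : ℝ)
      ≤ ((G.filter (fun i => x ∉ S i)).card : ℝ) := by exact_mod_cast hle
    have hadd' : ((G.filter (fun i => x ∈ S i)).card : ℝ) + ((G.filter (fun i => x ∉ S i)).card : ℝ) = G.card := by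
      exact_mod_cast hadd
    calc _ ≤ _ := hle'
      _ ≤ (G.card : ℝ) * (1 - p) := by linarith
      _ ≤ (F.card * (1 - p) ^ N) * (1 - p) := mul_le_mul_of_nonneg_right hF (by linarith)
      _ = _ := by ring

/-- the box with indices `f i = (k, j, j')` -/
def netBox (d M : ℕ) (f : Fin d → (Σ _ : ℕ, ℕ × ℕ)) : Set (Fin d → ℝ) :=
  Set.univ.pi fun i => perInterval ((f i).2.1 / (2 ^ (f i).1 * M : ℕ)) ((f i).2.2 / (2 ^ (f i).1 * M : ℕ))

def netT (M R : ℕ) : Finset (Σ _ : ℕ, ℕ × ℕ) :=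
  (Finset.range R).sigma fun k =>
    Finset.range (2 ^ k * M + 1) ×ˢ Finset.range (2 ^ k * M + 1)

open Classical in
def netF (d M R : ℕ) (ε : ℝ) : Finset (Fin d → (Σ _ : ℕ, ℕ × ℕ)) :=
  (Fintype.piFinset fun _ => netT M R).filter fun f =>
    ε ≤ ∏ i, (1/2 : ℝ) ^ (f i).1 ∧ ε / 2 ≤ volume.real (netBox d M f)

lemma geom_half (R : ℕ) : ∑ k ∈ Finset.range R, (1/2:ℝ) ^ k ≤ 2 := by
  have := Summable.sum_le_tsum (f := fun k : ℕ => (1/2:ℝ)^k) (Finset.range R)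
    (fun i _ => by positivity) summable_geometric_two
  rwa [tsum_geometric_two] at this

lemma netF_card (d M R : ℕ) (hM : 1 ≤ M) (ε : ℝ) (hε : 0 < ε) :
    ((netF d M R ε).card : ℝ) ≤ (1 / ε) ^ 3 * (8 * (M:ℝ) ^ 2) ^ d := by
  have h1 : ((netF d M R ε).card : ℝ) ≤
      ∑ f ∈ netF d M R ε, (1 / ε) ^ 3 * ∏ i, ((1/2 : ℝ) ^ (f i).1) ^ 3 := by
    have := Finset.card_nsmul_le_sum (netF d M R ε)
      (fun f => (1 / ε) ^ 3 * ∏ i, ((1/2 : ℝ) ^ (f i).1) ^ 3) 1 ?_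
    · simpa using this
    intro f hf
    have hf' := (Finset.mem_filter.1 hf).2.1
    rw [Finset.prod_pow, ← mul_pow]
    apply one_le_pow₀
    rw [one_div, inv_mul_eq_div, le_div_iff₀ hε]
    linarith
  refine h1.trans ?_
  rw [← Finset.mul_sum]
  apply mul_le_mul_of_nonneg_left _ (by positivity)
  calc _ ≤ ∑ f ∈ Fintype.piFinset (fun _ : Fin d => netT M R), ∏ i, ((1/2 : ℝ) ^ (f i).1) ^ 3 := by
        apply Finset.sum_le_sum_of_subset_of_nonneg (Finset.filter_subset _ _)
        intros; positivity
    _ = (∑ t ∈ netT M R, ((1/2 : ℝ) ^ t.1) ^ 3) ^ d := by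
        rw [Finset.sum_prod_piFinset (netT M R) (fun (_ : Fin d) t => ((1/2 : ℝ) ^ t.1) ^ 3)]
        simp
    _ ≤ _ := by
        apply pow_le_pow_left₀ (Finset.sum_nonneg (fun _ _ => by positivity))
        rw [netT, Finset.sum_sigma]
        calc _ ≤ ∑ k ∈ Finset.range R, 4 * (M:ℝ)^2 * (1/2:ℝ)^k := by
              apply Finset.sum_le_sum
              intro k _
              simp only [Finset.sum_const, Finset.card_product, Finset.card_range, nsmul_eq_mul]
              push_cast
              have hM' : (1:ℝ) ≤ M := by exact_mod_cast hM
              have hk : (1:ℝ) ≤ 2 ^ k := one_le_pow₀ (by norm_num)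
              have hq : (2:ℝ)^k * (1/2)^k = 1 := by rw [← mul_pow]; norm_num
              have h0 : (0:ℝ) < (1/2)^k := by positivity
              set q := (1/2:ℝ)^k
              set w := (2:ℝ)^k
              have : w * M + 1 ≤ 2 * (w * M) := by nlinarith
              calc (w * M + 1) * (w * M + 1) * q ^ 3 ≤ (2 * (w * M)) * (2 * (w * M)) * q ^ 3 := by
                    gcongr
                _ = 4 * (M:ℝ)^2 * (w * q)^2 * q := by ring
                _ = _ := by rw [hq]; ring
          _ = 4 * (M:ℝ)^2 * ∑ k ∈ Finset.range R, (1/2:ℝ)^k := by rw [Finset.mul_sum]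
          _ ≤ 4 * (M:ℝ)^2 * 2 := by gcongr; exact geom_half R
          _ = _ := by ring

lemma box_vol_s6 {d : ℕ} (s : Fin d → Set ℝ) :
    volume.real (Set.univ.pi s) = ∏ i, volume.real (s i) := by
  simp [Measure.real, volume_pi_pi, ENNReal.toReal_prod]

lemma vol_le_one {s : Set ℝ} (h : s ⊆ Icc 0 1) : volume.real s ≤ 1 := by
  have := measureReal_mono (μ := volume) h (by simp)
  simpa using this

lemma net_exists {d : ℕ} (hd : 1 ≤ d) (R : ℕ) (ε : ℝ) (hε : 0 < ε) (hR : (1/2:ℝ) ^ R < ε)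
    (B : Set (Fin d → ℝ)) (hB : IsPerBox B) (hv : ε < volume.real B) :
    ∃ f ∈ netF d (8 * d) R ε, netBox d (8 * d) f ⊆ B := by
  obtain ⟨a, b, ha, hb, hab, rfl⟩ := hB
  have ha' : ∀ i, a i ∈ Icc (0:ℝ) 1 := fun i => ha i trivial
  have hb' : ∀ i, b i ∈ Icc (0:ℝ) 1 := fun i => hb i trivial
  rw [box_vol_s6] at hv
  set ℓ : Fin d → ℝ := fun i => volume.real (perInterval (a i) (b i)) with hℓ
  have hl1 : ∀ i, ℓ i ≤ 1 := fun i => vol_le_one (perInterval_sub (ha' i) (hb' i))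
  have hl0 : ∀ i, 0 ≤ ℓ i := fun i => measureReal_nonneg
  have hlpos : ∀ i, 0 < ℓ i := by
    intro i
    refine lt_of_le_of_ne (hl0 i) fun h => ?_
    have : ∏ i, ℓ i = 0 := Finset.prod_eq_zero (Finset.mem_univ i) h.symm
    linarith
  have hk : ∀ i, ∃ k : ℕ, (1/2:ℝ)^(k+1) < ℓ i ∧ ℓ i ≤ (1/2:ℝ)^k := fun i =>
    exists_nat_pow_near_of_lt_one (hlpos i) (hl1 i) (by norm_num) (by norm_num)
  choose k hk1 hk2 using hk
  have hd' : (1:ℝ) ≤ d := by exact_mod_cast hd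
  have key : ∀ i, ∃ j : ℕ × ℕ, j.1 ≤ 2 ^ (k i) * (8 * d) ∧ j.2 ≤ 2 ^ (k i) * (8 * d) ∧
      perInterval (j.1 / (2 ^ (k i) * (8 * d) : ℕ)) (j.2 / (2 ^ (k i) * (8 * d) : ℕ))
        ⊆ perInterval (a i) (b i) ∧
      ℓ i * (1 + (-(1 / (2 * d)))) ≤ volume.real
        (perInterval (j.1 / (2 ^ (k i) * (8 * d) : ℕ)) (j.2 / (2 ^ (k i) * (8 * d) : ℕ))) := by
    intro i
    have hq : (2:ℝ)^k i * (1/2)^k i = 1 := by rw [← mul_pow]; norm_num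
    have h1 := hk1 i
    rw [pow_succ] at h1
    have hw : (0:ℝ) < 2 ^ k i := by positivity
    have hlw : 1 / 2 < ℓ i * 2 ^ k i := by nlinarith
    obtain ⟨j, j', h1, h2, h3, h4⟩ := one_dim_s6 (ha' i) (hb' i) (hab i) (2 ^ (k i) * (8 * d)) (by
      push_cast
      change 2 < ℓ i * _
      nlinarith)
    refine ⟨(j, j'), h1, h2, h3, le_trans ?_ h4⟩
    change _ ≤ ℓ i - _
    have : (2:ℝ) / (2 ^ (k i) * (8 * d) : ℕ) ≤ ℓ i * (1 / (2 * d)) := by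
      push_cast
      rw [div_le_iff₀ (by positivity)]
      field_simp
      nlinarith
    linarith
  choose j hj1 hj2 hj3 hj4 using key
  have hprodk : ε ≤ ∏ i, (1/2 : ℝ) ^ (k i) :=
    hv.le.trans (Finset.prod_le_prod (fun i _ => hl0 i) (fun i _ => hk2 i))
  refine ⟨fun i => ⟨k i, j i⟩, ?_, Set.pi_mono fun i _ => hj3 i⟩
  rw [netF, Finset.mem_filter]
  refine ⟨?_, hprodk, ?_⟩
  · rw [Fintype.mem_piFinset]
    intro i
    simp only [netT, Finset.mem_sigma, Finset.mem_product, Finset.mem_range]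
    refine ⟨?_, by have := hj1 i; omega, by have := hj2 i; omega⟩
    by_contra hcon
    push Not at hcon
    have h1 : (1/2:ℝ) ^ k i ≤ (1/2) ^ R := pow_le_pow_of_le_one (by norm_num) (by norm_num) hcon
    have h2 : ∏ i, ℓ i ≤ ℓ i := by
      rw [← Finset.mul_prod_erase _ _ (Finset.mem_univ i)]
      exact mul_le_of_le_one_right (hl0 i) (Finset.prod_le_one (fun i _ => hl0 i) (fun i _ => hl1 i))
    have := hk2 i
    linarith
  · rw [netBox, box_vol_s6]
    have h0 : (0:ℝ) ≤ 1 + (-(1 / (2 * d))) := by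
      have : (1:ℝ) / (2 * d) ≤ 1 := by
        rw [div_le_one (by positivity)]; linarith
      linarith
    have hbern : (1/2:ℝ) ≤ (1 + (-(1 / (2 * d)))) ^ d := by
      have := one_add_mul_le_pow (a := -(1 / (2 * (d:ℝ)))) (by linarith) d
      have h2 : (d:ℝ) * -(1 / (2 * d)) = -(1/2) := by field_simp
      linarith
    calc ε / 2 = ε * (1/2) := by ring
      _ ≤ (∏ i, ℓ i) * (1 + (-(1 / (2 * d)))) ^ d := by gcongr
      _ = ∏ i, (ℓ i * (1 + (-(1 / (2 * d))))) := by
        rw [Finset.prod_mul_distrib]; simp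
      _ ≤ _ := Finset.prod_le_prod (fun i _ => mul_nonneg (hl0 i) h0) (fun i _ => hj4 i)

lemma pdisp_nonneg {d : ℕ} (P : Set (Fin d → ℝ)) : 0 ≤ pdisp P := by
  apply Real.sSup_nonneg
  rintro v ⟨B, _, _, rfl⟩
  exact ENNReal.toReal_nonneg

lemma pNinv_le {d : ℕ} {ε : ℝ} (P : Finset (Fin d → ℝ)) (hP : ↑P ⊆ cube d)
    (h : pdisp (P : Set (Fin d → ℝ)) ≤ ε) : pNinv ε d ≤ P.card := by
  apply Nat.sInf_le
  show pminDisp P.card d ≤ ε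
  refine le_trans (csInf_le (a := pdisp (P : Set (Fin d → ℝ))) ⟨0, ?_⟩ ⟨P, hP, rfl, rfl⟩) h
  rintro v ⟨Q, _, _, rfl⟩
  exact pdisp_nonneg _

lemma netBox_sub {d M R : ℕ} (hM : 1 ≤ M) {ε : ℝ} {f} (hf : f ∈ netF d M R ε) :
    netBox d M f ⊆ cube d := by
  have h := (Finset.mem_filter.1 hf).1
  rw [Fintype.mem_piFinset] at h
  apply Set.pi_mono
  intro i _
  have hi := h i
  simp only [netT, Finset.mem_sigma, Finset.mem_product, Finset.mem_range] at hi
  have hm : (0:ℝ) < (2 ^ (f i).1 * M : ℕ) := by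
    have : 0 < 2 ^ (f i).1 * M := by positivity
    exact_mod_cast this
  apply perInterval_sub
  · refine ⟨by positivity, ?_⟩
    rw [div_le_one hm]
    exact_mod_cast (by omega : (f i).2.1 ≤ 2 ^ (f i).1 * M)
  · refine ⟨by positivity, ?_⟩
    rw [div_le_one hm]
    exact_mod_cast (by omega : (f i).2.2 ≤ 2 ^ (f i).1 * M)

lemma pNinv_bound {d : ℕ} (hd : 1 ≤ d) (ε : ℝ) (hε : 0 < ε) (hε1 : ε ≤ 1) (N : ℕ)
    (hN : (1 / ε) ^ 3 * (8 * ((8 * d : ℕ) : ℝ) ^ 2) ^ d * (1 - ε / 2) ^ N < 1) :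
    pNinv ε d ≤ N := by
  classical
  obtain ⟨R, hR⟩ := exists_pow_lt_of_lt_one hε (by norm_num : (1/2:ℝ) < 1)
  obtain ⟨P, hP, hcard, hF⟩ := hit (netF d (8 * d) R ε) (netBox d (8 * d)) (ε / 2) (by linarith)
    (fun f _ => MeasurableSet.univ_pi fun i => perInterval_meas _ _)
    (fun f hf => netBox_sub (by omega) hf)
    (fun f hf => (Finset.mem_filter.1 hf).2.2) N
  have hlt : ((Finset.filter (fun i => netBox d (8 * d) i ∩ (P : Set (Fin d → ℝ)) = ∅)
      (netF d (8 * d) R ε)).card : ℝ) < 1 := by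
    refine lt_of_le_of_lt hF (lt_of_le_of_lt ?_ hN)
    have : (0:ℝ) ≤ 1 - ε / 2 := by linarith
    exact mul_le_mul_of_nonneg_right (netF_card d (8 * d) R (by omega) ε hε) (by positivity)
  have h0 := Finset.card_eq_zero.1 (Nat.lt_one_iff.1 (by exact_mod_cast hlt))
  refine (pNinv_le P hP ?_).trans hcard
  apply Real.sSup_le _ hε.le
  rintro v ⟨B, hB, hBP, rfl⟩
  by_contra hcon
  push Not at hcon
  obtain ⟨f, hf, hfB⟩ := net_exists hd R ε hε hR B hB hcon
  have : f ∈ Finset.filter (fun i => netBox d (8 * d) i ∩ (P : Set (Fin d → ℝ)) = ∅)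
      (netF d (8 * d) R ε) := by
    rw [Finset.mem_filter]
    refine ⟨hf, ?_⟩
    rw [← subset_empty_iff, ← hBP]
    exact inter_subset_inter_left _ hfB
  rw [h0] at this
  simp at this

/-- There exists an absolute constant `C ≥ 1` such that for every integer `d ≥ 2` and every
`ε ∈ (0, 1/2]` with `ε ≤ exp(-d)`, one has `Ñ(ε,d) ≤ (C ln d / ε) · ln(1/ε)`. -/
theorem periodic_minimal_dispersion_inverse_bound_small_eps :
    ∃ C : ℝ, 1 ≤ C ∧ ∀ d : ℕ, 2 ≤ d → ∀ ε : ℝ, 0 < ε → ε ≤ 1 / 2 →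
      ε ≤ Real.exp (-(d : ℝ)) →
      (pNinv ε d : ℝ) ≤ C * Real.log d / ε * Real.log (1 / ε) := by
  refine ⟨40, by norm_num, ?_⟩
  intro d hd ε hε hε2 hεd
  have hd' : (2:ℝ) ≤ d := by exact_mod_cast hd
  have hl2 := Real.log_two_gt_d9
  have hl2' := Real.log_two_lt_d9
  have hD : Real.log 2 ≤ Real.log d := Real.log_le_log (by norm_num) hd'
  set D := Real.log d with hDdef
  set L := Real.log (1 / ε) with hLdef
  have hLd : (d:ℝ) ≤ L := by
    rw [hLdef, one_div, Real.log_inv]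
    have := Real.log_le_log hε hεd
    rw [Real.log_exp] at this
    linarith
  set A : ℝ := (1 / ε) ^ 3 * (8 * ((8 * d : ℕ) : ℝ) ^ 2) ^ d with hA
  have hApos : 0 < A := by positivity
  have hlogA : Real.log A ≤ 16 * L * D := by
    have h1 : Real.log A = 3 * L + d * (9 * Real.log 2 + 2 * D) := by
      rw [hA, Real.log_mul (by positivity) (by positivity), Real.log_pow, Real.log_pow]
      have : (8 * ((8 * d : ℕ) : ℝ) ^ 2) = 2 ^ 9 * (d:ℝ) ^ 2 := by push_cast; ring
      rw [this, Real.log_mul (by positivity) (by positivity), Real.log_pow, Real.log_pow]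
      push_cast
      ring
    rw [h1]
    have hL0 : 0 ≤ L := by linarith
    have h2 : d * (9 * Real.log 2 + 2 * D) ≤ L * (11 * D) := by
      apply mul_le_mul hLd (by linarith) (by linarith) hL0
    have h3 : L * 3 ≤ L * (5 * D) := mul_le_mul_of_nonneg_left (by linarith) hL0
    linarith
  have hLD : 1 ≤ L * D := by nlinarith
  set N : ℕ := ⌊32 * (L * D) / ε⌋₊ + 1 with hNdef
  have hNb : pNinv ε d ≤ N := by
    apply pNinv_bound (by omega) ε hε (by linarith)
    rw [← hA]
    have h1 : (1 - ε / 2) ^ N ≤ Real.exp (-(ε / 2) * N) := by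
      rw [mul_comm, Real.exp_nat_mul]
      apply pow_le_pow_left₀ (by linarith)
      have := Real.add_one_le_exp (-(ε / 2))
      linarith
    have hNlt : 32 * (L * D) / ε < N := by
      rw [hNdef]; push_cast; exact Nat.lt_floor_add_one _
    rw [div_lt_iff₀ hε] at hNlt
    calc A * (1 - ε / 2) ^ N ≤ A * Real.exp (-(ε / 2) * N) := by gcongr
      _ = Real.exp (Real.log A + -(ε / 2) * N) := by rw [Real.exp_add, Real.exp_log hApos]
      _ < 1 := by
        rw [Real.exp_lt_one_iff]
        linarith
  have hfl : (N:ℝ) ≤ 32 * (L * D) / ε + 1 := by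
    rw [hNdef]; push_cast
    have := Nat.floor_le (a := 32 * (L * D) / ε) (by positivity)
    linarith
  have h1 : 1 ≤ (L * D) / ε := by rw [le_div_iff₀ hε]; linarith
  calc (pNinv ε d : ℝ) ≤ N := by exact_mod_cast hNb
    _ ≤ 40 * ((L * D) / ε) := by
      have : 32 * (L * D) / ε = 32 * ((L * D) / ε) := by ring
      linarith
    _ = _ := by ring
end
end
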